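/- For N ∈ ℕ let X₁, …, X_N be i.i.d. uniform points on the torus [0,R)^d, let φ_N solve −Δφ_N = (Σₙ δ_{Xₙ})₁ − N R^{−d} on the torus (where (·)₁ denotes mollification at scale 1), and set f(N) := E_N ∫ (1/p)|∇φ_N|^p. Then f(N−1) ≤ f(N) for all N ≥ 1. -/

import Mathlib

open MeasureTheory

/-- The fundamental domain `[0, R)^d` of the torus. -/
def torusCube (d : ℕ) (R : ℝ) : Set (EuclideanSpace ℝ (Fin d)) :=
  {x | ∀ i, x i ∈ Set.Ico 0 R}

/-- The standard Gaussian at scale `1`, periodized over the lattice `(Rℤ)^d`: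
the mollification `(δ_0)₁` on the torus `[0,R)^d`. -/
noncomputable def perGauss (d : ℕ) (R : ℝ) (x : EuclideanSpace ℝ (Fin d)) : ℝ :=
  ∑' k : Fin d → ℤ,
    Real.exp (-‖x - (EuclideanSpace.equiv (Fin d) ℝ).symm (fun i => R * (k i : ℝ))‖ ^ 2 / 2)
      / (2 * Real.pi) ^ ((d : ℝ) / 2)

/-- The uniform probability measure on `[0,R)^d`. -/
noncomputable def unifCube (d : ℕ) (R : ℝ) : Measure (EuclideanSpace ℝ (Fin d)) :=
  (ENNReal.ofReal (R ^ d))⁻¹ • volume.restrict (torusCube d R)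

/-- Divergence of a vector field on `ℝ^d`. -/
noncomputable def divergence (d : ℕ)
    (f : EuclideanSpace ℝ (Fin d) → EuclideanSpace ℝ (Fin d))
    (x : EuclideanSpace ℝ (Fin d)) : ℝ :=
  ∑ i, fderiv ℝ f x (EuclideanSpace.single i 1) i

/-- Laplacian of a scalar function on `ℝ^d`. -/
noncomputable def lap (d : ℕ) (φ : EuclideanSpace ℝ (Fin d) → ℝ)
    (x : EuclideanSpace ℝ (Fin d)) : ℝ :=
  divergence d (gradient φ) x

/-- The expected `p`-energy `f(N) = E_N ∫ (1/p)|∇φ_N|^p` of the solution `φ_N` of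
`−Δφ_N = (Σₙ δ_{Xₙ})₁ − N R^{−d}` for `N` i.i.d. uniform points on the torus. -/
noncomputable def fEnergy (d : ℕ) (R p : ℝ)
    (Φ : (N : ℕ) → (Fin N → EuclideanSpace ℝ (Fin d)) → EuclideanSpace ℝ (Fin d) → ℝ)
    (N : ℕ) : ℝ :=
  ∫ ω, (∫ x in torusCube d R, (1 / p) * ‖gradient (Φ N ω) x‖ ^ p)
    ∂(Measure.pi fun _ : Fin N => unifCube d R)

section PeriodicFields

variable {d : ℕ} {R : ℝ}

/-- Invariance under translation by the lattice `(Rℤ)^d`, expressed on its generators. -/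
def LatticePeriodic {α : Type*} (R : ℝ) (f : EuclideanSpace ℝ (Fin d) → α) : Prop :=
  ∀ i, Function.Periodic f (R • EuclideanSpace.single i (1 : ℝ))

lemma torusCube_eq_preimage (d : ℕ) (R : ℝ) :
    torusCube d R = WithLp.ofLp ⁻¹' (Set.univ.pi fun _ : Fin d => Set.Ico 0 R) := by
  ext x; simp [torusCube]

lemma measurableSet_torusCube (d : ℕ) (R : ℝ) : MeasurableSet (torusCube d R) := by
  rw [torusCube_eq_preimage]
  exact (MeasurableSet.univ_pi fun _ => measurableSet_Ico).preimage
    (PiLp.continuous_ofLp 2 _).measurable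

lemma volume_torusCube (d : ℕ) (R : ℝ) : volume (torusCube d R) = ENNReal.ofReal R ^ d := by
  rw [← (PiLp.volume_preserving_toLp (Fin d)).measure_preimage
    (measurableSet_torusCube d R).nullMeasurableSet, torusCube_eq_preimage, ← Set.preimage_comp]
  change volume (Set.univ.pi fun _ : Fin d => Set.Ico (0 : ℝ) R) = _
  rw [Real.volume_pi_Ico]
  simp

lemma isProbabilityMeasure_unifCube (d : ℕ) (hR : 0 < R) :
    IsProbabilityMeasure (unifCube d R) := by
  constructor
  rw [unifCube, Measure.smul_apply, Measure.restrict_apply_univ, volume_torusCube,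
    ENNReal.ofReal_pow hR.le, smul_eq_mul]
  exact ENNReal.inv_mul_cancel (pow_ne_zero _ (by simpa using hR)) (by finiteness)

instance isFiniteMeasure_restrict_torusCube (d : ℕ) (R : ℝ) :
    IsFiniteMeasure (volume.restrict (torusCube d R)) :=
  ⟨by rw [Measure.restrict_apply_univ, volume_torusCube]; finiteness⟩

lemma torusCube_subset_image_Icc (d : ℕ) (R : ℝ) :
    torusCube d R ⊆ WithLp.toLp 2 '' Set.Icc (0 : Fin d → ℝ) fun _ => R :=
  fun x hx => ⟨WithLp.ofLp x, ⟨fun i => (hx i).1, fun i => (hx i).2.le⟩, rfl⟩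

lemma isCompact_toLp_image_Icc (d : ℕ) (R : ℝ) :
    IsCompact ((WithLp.toLp 2 : (Fin d → ℝ) → EuclideanSpace ℝ (Fin d)) ''
      Set.Icc (0 : Fin d → ℝ) fun _ => R) :=
  isCompact_Icc.image (PiLp.continuous_toLp 2 _)

lemma Continuous.integrableOn_torusCube {G : Type*} [NormedAddCommGroup G]
    {f : EuclideanSpace ℝ (Fin d) → G} (hf : Continuous f) :
    IntegrableOn f (torusCube d R) :=
  (hf.continuousOn.integrableOn_compact (isCompact_toLp_image_Icc d R)).mono_set
    (torusCube_subset_image_Icc d R)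

lemma setIntegral_torusCube {G : Type*} [NormedAddCommGroup G] [NormedSpace ℝ G]
    (f : EuclideanSpace ℝ (Fin d) → G) :
    ∫ x in torusCube d R, f x =
      ∫ y in Set.Icc (0 : Fin d → ℝ) fun _ => R, f (WithLp.toLp 2 y) := by
  rw [← (PiLp.volume_preserving_toLp (Fin d)).setIntegral_preimage_emb
    (MeasurableEquiv.toLp 2 _).measurableEmbedding, torusCube_eq_preimage, ← Set.preimage_comp]
  exact setIntegral_congr_set Measure.univ_pi_Ico_ae_eq_Icc

/-- The divergence of a periodic `C¹` vector field has zero mean. -/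
theorem integral_torusCube_divergence_eq_zero (hR : 0 ≤ R)
    {F : EuclideanSpace ℝ (Fin d) → EuclideanSpace ℝ (Fin d)} (hF : ContDiff ℝ 1 F)
    (hper : LatticePeriodic R F) :
    ∫ x in torusCube d R, divergence d F x = 0 := by
  rw [setIntegral_torusCube]
  cases d with
  | zero => simp [divergence]
  | succ n =>
  let L : (Fin (n + 1) → ℝ) →L[ℝ] EuclideanSpace ℝ (Fin (n + 1)) :=
    (PiLp.continuousLinearEquiv 2 ℝ fun _ : Fin (n + 1) => ℝ).symm.toContinuousLinearMap
  have hL : ∀ y, L y = WithLp.toLp 2 y := fun _ => rfl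
  have hdiff := hF.differentiable one_ne_zero
  have hfd := hF.continuous_fderiv one_ne_zero
  have hDF : ∀ y, divergence (n + 1) F (WithLp.toLp 2 y) =
      ∑ i, ((EuclideanSpace.proj i).comp ((fderiv ℝ F (L y)).comp L)) (Pi.single i 1) := by
    intro y
    simp only [divergence, hL, ContinuousLinearMap.comp_apply, PiLp.toLp_single]
    rfl
  simp_rw [hDF]
  rw [integral_divergence_of_hasFDerivAt_off_countable' 0 (fun _ => R) (fun _ => hR)
    (fun i y => F (L y) i) (fun i y => (EuclideanSpace.proj i).comp ((fderiv ℝ F (L y)).comp L))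
    ∅ Set.countable_empty]
  · refine Finset.sum_eq_zero fun i _ => ?_
    rw [sub_eq_zero]
    congr 1 with y
    have : L (i.insertNth R y) =
        L (i.insertNth 0 y) + R • EuclideanSpace.single i (1 : ℝ) := by
      ext j
      refine i.succAboveCases ?_ (fun k => ?_) j <;> simp [hL]
    simp only [this, hper i _, Pi.zero_apply]
  · intro i
    have := hF.continuous
    fun_prop
  · intro y _ i
    exact (EuclideanSpace.proj (𝕜 := ℝ) i).hasFDerivAt.comp y
      ((hdiff _).hasFDerivAt.comp y L.hasFDerivAt)
  · refine Continuous.integrableOn_Icc ?_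
    simp only [ContinuousLinearMap.comp_apply]
    fun_prop

lemma gradient_apply_eq_fderiv {f : EuclideanSpace ℝ (Fin d) → ℝ}
    (x : EuclideanSpace ℝ (Fin d)) (i : Fin d) :
    gradient f x i = fderiv ℝ f x (EuclideanSpace.single i 1) := by
  rw [← inner_gradient_left, EuclideanSpace.inner_single_right]
  simp

lemma ContDiff.gradient {f : EuclideanSpace ℝ (Fin d) → ℝ} (hf : ContDiff ℝ 2 f) :
    ContDiff ℝ 1 (gradient f) :=
  (InnerProductSpace.toDual ℝ _).symm.contDiff.comp
    (hf.fderiv_right (by norm_num))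

lemma gradient_comp_add_right (f : EuclideanSpace ℝ (Fin d) → ℝ)
    (x a : EuclideanSpace ℝ (Fin d)) :
    gradient (fun y => f (y + a)) x = gradient f (x + a) := by
  simp [gradient, fderiv_comp_add_right]

lemma LatticePeriodic.gradient {f : EuclideanSpace ℝ (Fin d) → ℝ} (hf : LatticePeriodic R f) :
    LatticePeriodic R (gradient f) := by
  intro i x
  rw [← gradient_comp_add_right, (funext (hf i) : (fun y => f (y + _)) = f)]

lemma divergence_sub {F G : EuclideanSpace ℝ (Fin d) → EuclideanSpace ℝ (Fin d)}
    {x : EuclideanSpace ℝ (Fin d)} (hF : DifferentiableAt ℝ F x) (hG : DifferentiableAt ℝ G x) :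
    divergence d (F - G) x = divergence d F x - divergence d G x := by
  simp [divergence, fderiv_sub hF hG, Finset.sum_sub_distrib]

lemma divergence_sum {ι : Type*} (s : Finset ι)
    {F : ι → EuclideanSpace ℝ (Fin d) → EuclideanSpace ℝ (Fin d)}
    {x : EuclideanSpace ℝ (Fin d)} (hF : ∀ j ∈ s, DifferentiableAt ℝ (F j) x) :
    divergence d (fun y => ∑ j ∈ s, F j y) x = ∑ j ∈ s, divergence d (F j) x := by
  simp only [divergence, fderiv_fun_sum hF]
  rw [Finset.sum_comm]
  simp

lemma divergence_comp_sub_right (F : EuclideanSpace ℝ (Fin d) → EuclideanSpace ℝ (Fin d))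
    (x a : EuclideanSpace ℝ (Fin d)) :
    divergence d (fun y => F (y - a)) x = divergence d F (x - a) := by
  simp only [divergence, sub_eq_add_neg, fderiv_comp_add_right]

lemma divergence_smul {u : EuclideanSpace ℝ (Fin d) → ℝ}
    {F : EuclideanSpace ℝ (Fin d) → EuclideanSpace ℝ (Fin d)} {x : EuclideanSpace ℝ (Fin d)}
    (hu : DifferentiableAt ℝ u x) (hF : DifferentiableAt ℝ F x) :
    divergence d (fun y => u y • F y) x =
      u x * divergence d F x + inner ℝ (gradient u x) (F x) := by
  simp only [divergence, fderiv_fun_smul hu hF, PiLp.inner_apply, gradient_apply_eq_fderiv,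
    Finset.mul_sum, ← Finset.sum_add_distrib]
  refine Finset.sum_congr rfl fun i _ => ?_
  simp [mul_comm]

/-- The gradient of a periodic function has zero mean. -/
theorem integral_torusCube_gradient_eq_zero (hR : 0 ≤ R) {u : EuclideanSpace ℝ (Fin d) → ℝ}
    (hu : ContDiff ℝ 2 u) (hper : LatticePeriodic R u) :
    ∫ x in torusCube d R, gradient u x = 0 := by
  ext i
  have hint : IntegrableOn (gradient u) (torusCube d R) :=
    hu.gradient.continuous.integrableOn_torusCube
  have h := integral_torusCube_divergence_eq_zero hR
    (F := fun y => u y • EuclideanSpace.single i (1 : ℝ))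
    ((hu.of_le one_le_two).smul contDiff_const) (fun j x => by simp only [hper j x])
  have h1 : ∀ x, divergence d (fun y => u y • EuclideanSpace.single i (1 : ℝ)) x =
      EuclideanSpace.proj (𝕜 := ℝ) i (gradient u x) := by
    intro x
    rw [divergence_smul (hu.differentiable two_ne_zero x) (differentiableAt_const _)]
    simp [divergence, gradient_apply_eq_fderiv]
  simp only [h1] at h
  rw [ContinuousLinearMap.integral_comp_comm _ hint] at h
  exact h

/-- A periodic harmonic function has almost everywhere vanishing gradient. -/
theorem gradient_ae_eq_zero_of_lap_eq_zero (hR : 0 ≤ R) {u : EuclideanSpace ℝ (Fin d) → ℝ}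
    (hu : ContDiff ℝ 2 u) (hper : LatticePeriodic R u) (hlap : ∀ x, lap d u x = 0) :
    ∀ᵐ x ∂volume.restrict (torusCube d R), gradient u x = 0 := by
  have hc := hu.gradient.continuous
  have h := integral_torusCube_divergence_eq_zero hR (F := fun y => u y • gradient u y)
    ((hu.of_le one_le_two).smul hu.gradient)
    (fun j x => by simp only [hper j x, hper.gradient j x])
  have h1 : ∀ x, divergence d (fun y => u y • gradient u y) x = ‖gradient u x‖ ^ 2 := by
    intro x
    rw [divergence_smul (hu.differentiable two_ne_zero x)
      (hu.gradient.differentiable one_ne_zero x), real_inner_self_eq_norm_sq]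
    have := hlap x
    rw [lap] at this
    rw [this, mul_zero, zero_add]
  simp only [h1] at h
  rw [setIntegral_eq_zero_iff_of_nonneg_ae (Filter.Eventually.of_forall fun x => by positivity)
    (Continuous.integrableOn_torusCube (by fun_prop))] at h
  filter_upwards [h] with x hx
  simpa using hx

/-- A continuous periodic function is bounded. -/
lemma LatticePeriodic.exists_norm_le {G : Type*} [NormedAddCommGroup G] (hR : 0 < R)
    {f : EuclideanSpace ℝ (Fin d) → G} (hf : Continuous f) (hper : LatticePeriodic R f) :
    ∃ C, ∀ x, ‖f x‖ ≤ C := by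
  obtain ⟨C, hC⟩ := (isCompact_toLp_image_Icc d R).exists_bound_of_continuousOn hf.continuousOn
  refine ⟨C, fun x => ?_⟩
  have hsum : ∀ (k : Fin d → ℤ) (s : Finset (Fin d)),
      Function.Periodic f (∑ i ∈ s, k i • (R • EuclideanSpace.single i (1 : ℝ))) := by
    intro k s
    induction s using Finset.cons_induction with
    | empty => intro x; simp
    | cons i s hi ih =>
      rw [Finset.sum_cons]
      exact ((hper i).zsmul (k i)).add_period ih
  rw [← (hsum (fun i => -⌊x i / R⌋) Finset.univ) x]
  refine hC _ (torusCube_subset_image_Icc d R fun j => ?_)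
  have : (x + ∑ i, (-⌊x i / R⌋) • (R • EuclideanSpace.single i (1 : ℝ))) j
      = R * Int.fract (x j / R) := by
    have h : (∑ i, (-⌊x i / R⌋) • (R • EuclideanSpace.single i (1 : ℝ))) j
        = -(R * ⌊x j / R⌋) := by
      simp [Pi.single_apply, mul_comm]
    rw [PiLp.add_apply, h, ← Int.self_sub_floor, mul_sub, mul_div_cancel₀ _ hR.ne']
    ring
  rw [this]
  exact ⟨by positivity, by nlinarith [Int.fract_lt_one (x j / R)]⟩

end PeriodicFields

/-- The `p`-energy density is convex. -/
lemma convexOn_norm_rpow_div {E : Type*} [NormedAddCommGroup E] [NormedSpace ℝ E] {p : ℝ}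
    (hp : 1 ≤ p) : ConvexOn ℝ Set.univ fun z : E => (1 / p) * ‖z‖ ^ p := by
  have h : ConvexOn ℝ Set.univ fun z : E => ‖z‖ ^ p := by
    have hconv : ConvexOn ℝ Set.univ (norm : E → ℝ) := convexOn_univ_norm
    refine ⟨convex_univ, fun x _ y _ a b ha hb hab => ?_⟩
    refine (Real.rpow_le_rpow (norm_nonneg _) (hconv.2 trivial trivial ha hb hab)
      (by positivity)).trans ?_
    exact (convexOn_rpow hp).2 (norm_nonneg x) (norm_nonneg y) ha hb hab
  exact h.smul (by positivity)

section Superposition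

variable {E : Type*} [NormedAddCommGroup E] [NormedSpace ℝ E] [FiniteDimensional ℝ E]
  [MeasurableSpace E] [BorelSpace E]

/-- Adding an independent mean-zero field to a superposition of independent fields increases the
expected integral of every convex energy density. -/
theorem integral_convex_sum_le_succ {ν lam : Measure E} [IsProbabilityMeasure ν]
    [IsFiniteMeasure lam] {H : E → ℝ} (hH : ConvexOn ℝ Set.univ H) (hHc : Continuous H)
    {V : E → E} (hV : Continuous V) {C : ℝ} (hC : ∀ x, ‖V x‖ ≤ C)
    (hmean : ∀ x, ∫ y, V (x - y) ∂ν = 0) (M : ℕ) :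
    ∫ ω, ∫ x, H (∑ n, V (x - ω n)) ∂lam ∂(Measure.pi fun _ : Fin M => ν) ≤
      ∫ ω, ∫ x, H (∑ n, V (x - ω n)) ∂lam ∂(Measure.pi fun _ : Fin (M + 1) => ν) := by
  have : ProperSpace E := FiniteDimensional.proper_real E
  have : SecondCountableTopology E := secondCountable_of_proper
  have hbound : ∀ N : ℕ, ∃ B, ∀ (ω : Fin N → E) (x : E), ‖H (∑ n, V (x - ω n))‖ ≤ B := by
    intro N
    obtain ⟨B, hB⟩ := (isCompact_closedBall (0 : E) (N * C)).exists_bound_of_continuousOn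
      hHc.continuousOn
    refine ⟨B, fun ω x => hB _ ?_⟩
    rw [mem_closedBall_zero_iff]
    refine (norm_sum_le_of_le _ fun n _ => hC _).trans ?_
    simp
  have hcont : ∀ N : ℕ, Continuous fun q : (Fin N → E) × E => H (∑ n, V (q.2 - q.1 n)) := by
    intro N; fun_prop
  have hint : ∀ N : ℕ, Integrable (fun q : (Fin N → E) × E => H (∑ n, V (q.2 - q.1 n)))
      ((Measure.pi fun _ => ν).prod lam) := fun N =>
    let ⟨B, hB⟩ := hbound N
    Integrable.of_bound (hcont N).aestronglyMeasurable B (.of_forall fun q => hB q.1 q.2)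
  have hmp := (measurePreserving_piFinSuccAbove (fun _ : Fin (M + 1) => ν) 0).symm
  rw [← hmp.integral_comp (MeasurableEquiv.measurableEmbedding _)]
  have hg := (hint (M + 1)).integral_prod_left
  rw [← hmp.integrable_comp_emb (MeasurableEquiv.measurableEmbedding _)] at hg
  simp only [Function.comp_def] at hg
  rw [integral_prod_symm _ hg]
  refine integral_mono (hint M).integral_prod_left hg.integral_prod_right fun ω => ?_
  have hsplit : ∀ y x : E,
      ∑ n, V (x - (MeasurableEquiv.piFinSuccAbove (fun _ => E) 0).symm (y, ω) n) =
        V (x - y) + ∑ n, V (x - ω n) := by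
    intro y x
    rw [Fin.sum_univ_succ]
    rfl
  simp only [hsplit]
  obtain ⟨B, hB⟩ := hbound (M + 1)
  have hB' : ∀ y x : E, ‖H (V (x - y) + ∑ n, V (x - ω n))‖ ≤ B := fun y x => by
    rw [← hsplit]; exact hB _ x
  have hjoint : Integrable (Function.uncurry fun y x : E => H (V (x - y) + ∑ n, V (x - ω n)))
      (ν.prod lam) :=
    Integrable.of_bound (by
      refine Continuous.aestronglyMeasurable ?_
      simp only [Function.uncurry_def]
      fun_prop) B (.of_forall fun q => hB' q.1 q.2)
  rw [integral_integral_swap hjoint]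
  refine integral_mono ?_ hjoint.integral_prod_right fun x => ?_
  · obtain ⟨B, hB⟩ := hbound M
    exact Integrable.of_bound (Continuous.aestronglyMeasurable (by fun_prop)) B
      (.of_forall (hB ω))
  · have hVint : Integrable (fun y => V (x - y)) ν :=
      Integrable.of_bound (Continuous.aestronglyMeasurable (by fun_prop)) C
        (.of_forall fun y => hC _)
    have hJ := hH.map_integral_le (μ := ν) (f := fun y => V (x - y) + ∑ n, V (x - ω n))
      hHc.continuousOn isClosed_univ (.of_forall fun _ => trivial)
      (hVint.add (integrable_const _))
      (Integrable.of_bound (Continuous.aestronglyMeasurable (by fun_prop)) B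
        (.of_forall fun y => hB' y x))
    rw [integral_add hVint (integrable_const _), hmean] at hJ
    simpa using hJ

end Superposition

section Torus

variable {d : ℕ} {R : ℝ}

/-- The reflected and translated gradient of a periodic function has zero mean against the uniform
measure. -/
lemma integral_unifCube_gradient_sub_eq_zero (hR : 0 ≤ R) {u : EuclideanSpace ℝ (Fin d) → ℝ}
    (hu : ContDiff ℝ 2 u) (hper : LatticePeriodic R u) (x : EuclideanSpace ℝ (Fin d)) :
    ∫ y, gradient u (x - y) ∂unifCube d R = 0 := by
  have h := integral_torusCube_gradient_eq_zero (u := fun y => u (x - y)) hR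
    (hu.comp (contDiff_const.sub contDiff_id)) fun i y => by
      simp only [← sub_sub, (hper i).sub_eq]
  have hgrad : ∀ y, gradient (fun y => u (x - y)) y = -gradient u (x - y) := fun y => by
    have hfd : fderiv ℝ (fun y => u (x - y)) y = -fderiv ℝ u (x - y) := by
      refine ((hu.differentiable two_ne_zero (x - y)).hasFDerivAt.comp y
        ((hasFDerivAt_id y).const_sub x)).fderiv.trans ?_
      ext v
      simp
    simp [gradient, hfd]
  simp only [hgrad, integral_neg, neg_eq_zero] at h
  rw [unifCube, integral_smul_measure, h, smul_zero]

/-- The gradient of a periodic solution with several sources is the superposition of the gradients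
of translates of the one-source solution. -/
lemma gradient_ae_eq_sum_gradient_sub (hR : 0 ≤ R) {ι : Type*} [Fintype ι]
    {u w : EuclideanSpace ℝ (Fin d) → ℝ} (hu : ContDiff ℝ 2 u) (hw : ContDiff ℝ 2 w)
    (hup : LatticePeriodic R u) (hwp : LatticePeriodic R w) (a : ι → EuclideanSpace ℝ (Fin d))
    (hlap : ∀ x, lap d u x = ∑ n, lap d w (x - a n)) :
    ∀ᵐ x ∂volume.restrict (torusCube d R), gradient u x = ∑ n, gradient w (x - a n) := by
  have hgrad : gradient (fun x => u x - ∑ n, w (x - a n)) =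
      gradient u - fun x => ∑ n, gradient w (x - a n) := by
    ext1 x
    have hwd : ∀ n, DifferentiableAt ℝ (fun x => w (x - a n)) x := fun n =>
      (hw.differentiable two_ne_zero _).comp x (differentiableAt_id.sub_const _)
    simp only [gradient, Pi.sub_apply]
    rw [fderiv_fun_sub (hu.differentiable two_ne_zero x) (.fun_sum fun n _ => hwd n),
      fderiv_fun_sum fun n _ => hwd n]
    simp [sub_eq_add_neg, fderiv_comp_add_right]
  have hgd : ∀ n x, DifferentiableAt ℝ (fun x => gradient w (x - a n)) x := fun n x =>
    (hw.gradient.differentiable one_ne_zero _).comp x (differentiableAt_id.sub_const _)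
  have h := gradient_ae_eq_zero_of_lap_eq_zero (u := fun x => u x - ∑ n, w (x - a n)) hR
    (hu.sub (ContDiff.sum fun n _ => hw.comp (contDiff_id.sub contDiff_const)))
    (fun i x => by simp only [hup i x, add_sub_right_comm, hwp i _]) (fun x => by
      rw [lap, hgrad, divergence_sub (hu.gradient.differentiable one_ne_zero x)
        (.fun_sum fun n _ => hgd n x), divergence_sum _ fun n _ => hgd n x]
      simp only [divergence_comp_sub_right]
      exact sub_eq_zero.2 (hlap x))
  filter_upwards [h] with x hx
  rw [hgrad] at hx
  exact sub_eq_zero.1 hx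

end Torus

/-- Monotonicity in `N` of the expected `p`-energy: `f(N−1) ≤ f(N)` for `N ≥ 1`. -/
theorem energy_monotone (d : ℕ) (R p : ℝ) (hd : 1 ≤ d) (hR : 1 ≤ R) (hp : 1 < p)
    (Φ : (N : ℕ) → (Fin N → EuclideanSpace ℝ (Fin d)) → EuclideanSpace ℝ (Fin d) → ℝ)
    (hsmooth : ∀ N ω, ContDiff ℝ 2 (Φ N ω))
    (hper : ∀ N ω x i, Φ N ω (x + R • EuclideanSpace.single i 1) = Φ N ω x)
    (hPDE : ∀ N ω x,
      -(lap d (Φ N ω) x) = (∑ n, perGauss d R (x - ω n)) - N / R ^ d) :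
    ∀ N : ℕ, 1 ≤ N → fEnergy d R p Φ (N - 1) ≤ fEnergy d R p Φ N := by
  have hR0 : 0 < R := by linarith
  have := isProbabilityMeasure_unifCube d hR0
  have hperΦ : ∀ N ω, LatticePeriodic R (Φ N ω) := fun N ω i x => hper N ω x i
  set w := Φ 1 fun _ => 0 with hw
  have hw2 : ContDiff ℝ 2 w := hsmooth _ _
  have hwp : LatticePeriodic R w := hperΦ _ _
  have hwlap : ∀ x, lap d w x = 1 / R ^ d - perGauss d R x := fun x => by
    have := hPDE 1 (fun _ => 0) x
    simp only [Finset.univ_unique, Finset.sum_singleton, sub_zero, Nat.cast_one, ← hw] at this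
    linarith
  have hsum : ∀ N ω, ∀ᵐ x ∂volume.restrict (torusCube d R),
      gradient (Φ N ω) x = ∑ n, gradient w (x - ω n) := fun N ω =>
    gradient_ae_eq_sum_gradient_sub hR0.le (hsmooth N ω) hw2 (hperΦ N ω) hwp ω fun x => by
      simp only [hwlap, Finset.sum_sub_distrib]
      have := hPDE N ω x
      simp only [Finset.sum_const, Finset.card_univ, Fintype.card_fin, nsmul_eq_mul, mul_one_div]
      linarith
  have henergy : ∀ N, fEnergy d R p Φ N =
      ∫ ω, (∫ x in torusCube d R, (1 / p) * ‖∑ n, gradient w (x - ω n)‖ ^ p)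
        ∂(Measure.pi fun _ : Fin N => unifCube d R) := fun N => by
    refine integral_congr_ae (.of_forall fun ω => integral_congr_ae ?_)
    filter_upwards [hsum N ω] with x hx
    rw [hx]
  obtain ⟨C, hC⟩ := hwp.gradient.exists_norm_le hR0 hw2.gradient.continuous
  intro N hN
  obtain ⟨M, rfl⟩ := Nat.exists_eq_add_of_le' hN
  rw [Nat.add_sub_cancel, henergy, henergy]
  exact integral_convex_sum_le_succ (convexOn_norm_rpow_div hp.le)
    (continuous_const.mul (continuous_norm.rpow_const fun _ => Or.inr (by linarith)))
    hw2.gradient.continuous hC (integral_unifCube_gradient_sub_eq_zero hR0.le hw2 hwp) M
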